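/- Suppose k ≥ 1 and n + l ≥ 2, and fix y ∈ Y and distinct a, b ∈ X ∪ Z. Then for every integer m ≥ 1 the elements C_{y,a}^m · C_{b,y} · C_{y,a}^{-m} and C_{a,y} · C_{b,y} both lie in K_{n,k,l} and commute with each other in Aut(F). -/

import Mathlib

namespace Birman

/-- The generating set of the free group `F_{n,k,l}`: `X ∪ Y ∪ Z`. -/
abbrev Gen (n k l : ℕ) := Fin n ⊕ (Fin k ⊕ Fin l)

/-- The free group `F_{n,k,l}` on `X ∪ Y ∪ Z`. -/
abbrev FG (n k l : ℕ) := FreeGroup (Gen n k l)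

variable {n k l : ℕ}

/-- The generator `x_i`. -/
def xg (n k l : ℕ) (i : Fin n) : Gen n k l := Sum.inl i
/-- The generator `y_j`. -/
def yg (n k l : ℕ) (j : Fin k) : Gen n k l := Sum.inr (Sum.inl j)
/-- The generator `z_m`. -/
def zg (n k l : ℕ) (m : Fin l) : Gen n k l := Sum.inr (Sum.inr m)

/-- `A_{n,k,l}`: automorphisms sending each generator in `Y ∪ Z` to a conjugate of itself. -/
def A (n k l : ℕ) : Subgroup (MulAut (FG n k l)) where
  carrier := {f | ∀ s : Fin k ⊕ Fin l,
    IsConj (FreeGroup.of (Sum.inr s : Gen n k l)) (f (FreeGroup.of (Sum.inr s)))}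
  one_mem' := by
    intro s
    rw [MulAut.one_apply]
  mul_mem' := by
    intro f g hf hg s
    rw [MulAut.mul_apply]
    exact (hf s).trans (f.toMonoidHom.map_isConj (hg s))
  inv_mem' := by
    intro f hf s
    have h := (f⁻¹ : MulAut (FG n k l)).toMonoidHom.map_isConj (hf s)
    simp only [MulEquiv.toMonoidHom_eq_coe, MonoidHom.coe_coe] at h
    have h2 : (f⁻¹ : MulAut (FG n k l)) (f (FreeGroup.of (Sum.inr s))) = FreeGroup.of (Sum.inr s) :=
      MulAut.inv_apply_self _ f _
    rw [h2] at h
    exact h.symm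

/-- The projection `F_{n,k,l} → F_{n,0,l}` killing the generators in `Y`. -/
def proj (n k l : ℕ) : FG n k l →* FG n 0 l :=
  FreeGroup.lift fun g => match g with
    | Sum.inl i => FreeGroup.of (Sum.inl i)
    | Sum.inr (Sum.inl _) => 1
    | Sum.inr (Sum.inr m) => FreeGroup.of (Sum.inr (Sum.inr m))

/-- Automorphisms commuting with the projection to `F_{n,0,l}`, i.e. inducing the identity
on `F_{n,k,l}/N ≅ F_{n,0,l}`. -/
def fixProj (n k l : ℕ) : Subgroup (MulAut (FG n k l)) where
  carrier := {f | ∀ w : FG n k l, proj n k l (f w) = proj n k l w}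
  one_mem' := by intro w; simp
  mul_mem' := by
    intro f g hf hg w
    rw [MulAut.mul_apply]
    exact (hf (g w)).trans (hg w)
  inv_mem' := by
    intro f hf w
    have h := hf ((f⁻¹ : MulAut (FG n k l)) w)
    rw [MulAut.apply_inv_self] at h
    exact h.symm

/-- `K_{n,k,l}`, the kernel of `ρ : A_{n,k,l} → A_{n,0,l}`: those elements of `A_{n,k,l}`
that induce the identity automorphism of `F_{n,k,l}/N ≅ F_{n,0,l}`. -/
def K (n k l : ℕ) : Subgroup (MulAut (FG n k l)) := A n k l ⊓ fixProj n k l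

/-- `f` is the automorphism `M_{v,w}` : `v ↦ w v`, fixing all other generators. -/
def IsMul (f : MulAut (FG n k l)) (v w : Gen n k l) : Prop :=
  f (FreeGroup.of v) = FreeGroup.of w * FreeGroup.of v ∧
    ∀ u : Gen n k l, u ≠ v → f (FreeGroup.of u) = FreeGroup.of u

/-- `f` is the automorphism `M_{v⁻¹,w}` : `v ↦ v w⁻¹`, fixing all other generators. -/
def IsMulInv (f : MulAut (FG n k l)) (v w : Gen n k l) : Prop :=
  f (FreeGroup.of v) = FreeGroup.of v * (FreeGroup.of w)⁻¹ ∧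
    ∀ u : Gen n k l, u ≠ v → f (FreeGroup.of u) = FreeGroup.of u

/-- `f` is the automorphism `C_{v,w}` : `v ↦ w v w⁻¹`, fixing all other generators. -/
def IsConjGen (f : MulAut (FG n k l)) (v w : Gen n k l) : Prop :=
  f (FreeGroup.of v) = FreeGroup.of w * FreeGroup.of v * (FreeGroup.of w)⁻¹ ∧
    ∀ u : Gen n k l, u ≠ v → f (FreeGroup.of u) = FreeGroup.of u

end Birman

namespace Birman

/-- The generator of `F_{n,k,l}` corresponding to an element of `X ∪ Z`. -/
def xzg (n k l : ℕ) (s : Fin n ⊕ Fin l) : Gen n k l :=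
  match s with
  | Sum.inl i => Sum.inl i
  | Sum.inr m => Sum.inr (Sum.inr m)

/-- An automorphism conjugating every generator by an element of the kernel of `proj` is in `K`. -/
theorem mem_K_of_conj (n k l : ℕ) (g : MulAut (FG n k l))
    (hg : ∀ u : Gen n k l, ∃ c : FG n k l, proj n k l c = 1 ∧
      g (FreeGroup.of u) = c * FreeGroup.of u * c⁻¹) : g ∈ K n k l := by
  refine Subgroup.mem_inf.2 ⟨?_, ?_⟩
  · intro s
    obtain ⟨c, -, hc⟩ := hg (Sum.inr s)
    exact isConj_iff.2 ⟨c, hc.symm⟩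
  · have h : (proj n k l).comp g.toMonoidHom = proj n k l := by
      ext u
      obtain ⟨c, hc1, hc⟩ := hg u
      simp [hc, hc1]
    intro w
    exact DFunLike.congr_fun h w

/-- Positive powers of a partial conjugation. -/
theorem conjGen_pow {n k l : ℕ} {f : MulAut (FG n k l)} {v w : Gen n k l} (hvw : w ≠ v)
    (hf : IsConjGen f v w) (m : ℕ) :
    (f ^ m) (FreeGroup.of v) = FreeGroup.of w ^ m * FreeGroup.of v * (FreeGroup.of w ^ m)⁻¹ ∧
    ∀ u : Gen n k l, u ≠ v → (f ^ m) (FreeGroup.of u) = FreeGroup.of u := by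
  induction m with
  | zero => simp
  | succ m ih =>
    refine ⟨?_, fun u hu => ?_⟩
    · rw [pow_succ, MulAut.mul_apply, hf.1, map_mul, map_mul, map_inv, ih.1, ih.2 w hvw,
        pow_succ' (FreeGroup.of w)]
      group
    · rw [pow_succ, MulAut.mul_apply, hf.2 u hu, ih.2 u hu]

/-- Suppose `k ≥ 1` and `n + l ≥ 2`; fix `y ∈ Y` and distinct `a, b ∈ X ∪ Z`.  Then for every
integer `m ≥ 1` the elements `C_{y,a}^m C_{b,y} C_{y,a}^{-m}` and `C_{a,y} C_{b,y}` lie in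
`K_{n,k,l}` and commute with each other in `Aut(F)`. -/
theorem abelianCycle_elements (n k l : ℕ) (hk : 1 ≤ k) (hnl : 2 ≤ n + l)
    (y : Fin k) (a b : Fin n ⊕ Fin l) (hab : a ≠ b)
    (Cya Cby Cay : MulAut (FG n k l))
    (hCya : IsConjGen Cya (yg n k l y) (xzg n k l a))
    (hCby : IsConjGen Cby (xzg n k l b) (yg n k l y))
    (hCay : IsConjGen Cay (xzg n k l a) (yg n k l y))
    (m : ℤ) (hm : 1 ≤ m) :
    Cya ^ m * Cby * (Cya ^ m)⁻¹ ∈ K n k l ∧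
    Cay * Cby ∈ K n k l ∧
    Commute (Cya ^ m * Cby * (Cya ^ m)⁻¹) (Cay * Cby) := by
  obtain ⟨p, rfl⟩ := Int.eq_ofNat_of_zero_le (by omega : (0 : ℤ) ≤ m)
  have hay : xzg n k l a ≠ yg n k l y := by cases a <;> simp [xzg, yg]
  have hby : xzg n k l b ≠ yg n k l y := by cases b <;> simp [xzg, yg]
  have hba : xzg n k l b ≠ xzg n k l a := by
    cases a <;> cases b <;> simp_all [xzg, eq_comm]
  have hpy : proj n k l (FreeGroup.of (yg n k l y)) = 1 := by simp [proj, yg]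
  obtain ⟨hP1, hP2⟩ := conjGen_pow hay hCya p
  rw [zpow_natCast]
  generalize Cya ^ p = P at hP1 hP2
  generalize xzg n k l a = α at *
  generalize xzg n k l b = β at *
  generalize yg n k l y = η at *
  have hPi : ∀ u, u ≠ η → P⁻¹ (FreeGroup.of u) = FreeGroup.of u := by
    intro u hu
    apply P.injective
    rw [MulAut.apply_inv_self, hP2 u hu]
  have hPy : P⁻¹ (FreeGroup.of η) =
      (FreeGroup.of α ^ p)⁻¹ * FreeGroup.of η * FreeGroup.of α ^ p := by
    apply P.injective
    rw [MulAut.apply_inv_self, map_mul, map_mul, map_inv, map_pow, hP1, hP2 α hay]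
    group
  have hg1 : (P * Cby * P⁻¹) (FreeGroup.of β) =
      (FreeGroup.of α ^ p * FreeGroup.of η * (FreeGroup.of α ^ p)⁻¹) * FreeGroup.of β *
      (FreeGroup.of α ^ p * FreeGroup.of η * (FreeGroup.of α ^ p)⁻¹)⁻¹ := by
    rw [MulAut.mul_apply, MulAut.mul_apply, hPi β hby, hCby.1, map_mul, map_mul, map_inv,
      hP1, hP2 β hby]
  have hg2 : ∀ u, u ≠ β → (P * Cby * P⁻¹) (FreeGroup.of u) = FreeGroup.of u := by
    intro u hu
    rw [MulAut.mul_apply, MulAut.mul_apply]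
    by_cases huy : u = η
    · subst huy
      rw [hPy]
      simp only [map_mul, map_inv, map_pow]
      rw [hCby.2 α hba.symm, hCby.2 u hu, hP1, hP2 α hay]
      group
    · rw [hPi u huy, hCby.2 u hu, hP2 u huy]
  have hh1 : (Cay * Cby) (FreeGroup.of β) =
      FreeGroup.of η * FreeGroup.of β * (FreeGroup.of η)⁻¹ := by
    rw [MulAut.mul_apply, hCby.1, map_mul, map_mul, map_inv, hCay.2 β hba, hCay.2 η hay.symm]
  have hh2 : (Cay * Cby) (FreeGroup.of α) =
      FreeGroup.of η * FreeGroup.of α * (FreeGroup.of η)⁻¹ := by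
    rw [MulAut.mul_apply, hCby.2 α hba.symm, hCay.1]
  have hh3 : ∀ u, u ≠ α → u ≠ β → (Cay * Cby) (FreeGroup.of u) = FreeGroup.of u := by
    intro u h1 h2
    rw [MulAut.mul_apply, hCby.2 u h2, hCay.2 u h1]
  generalize P * Cby * P⁻¹ = g at *
  generalize Cay * Cby = h at *
  refine ⟨mem_K_of_conj n k l g fun u => ?_, mem_K_of_conj n k l h fun u => ?_, ?_⟩
  · by_cases hu : u = β
    · subst hu
      exact ⟨_, by simp [hpy], hg1⟩
    · exact ⟨1, by simp, by simp [hg2 u hu]⟩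
  · by_cases hu : u = β
    · subst hu
      exact ⟨_, hpy, hh1⟩
    · by_cases hu' : u = α
      · subst hu'
        exact ⟨_, hpy, hh2⟩
      · exact ⟨1, by simp, by simp [hh3 u hu' hu]⟩
  · have key : (g * h).toMonoidHom = (h * g).toMonoidHom := by
      ext u
      change g (h (FreeGroup.of u)) = h (g (FreeGroup.of u))
      have hgα := hg2 α hba.symm
      have hgη := hg2 η hby.symm
      have hhη := hh3 η hay.symm hby.symm
      by_cases hu : u = β
      · subst hu
        rw [hh1, hg1]
        simp only [map_mul, map_inv, map_pow]
        rw [hgη, hg1, hh1, hh2, hhη, conj_pow]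
        group
      · rw [hg2 u hu]
        by_cases hu' : u = α
        · subst hu'
          rw [hh2]
          simp only [map_mul, map_inv]
          rw [hgα, hgη]
        · rw [hh3 u hu' hu, hg2 u hu]
    exact MulEquiv.ext fun x => DFunLike.congr_fun key x

end Birman
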